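/- arXiv:2410.08104 — 6 statements merged into one kernel-verified Lean document; each statement's English description precedes it below -/
import Mathlib

section
/- Let S be a nonempty set and let f, g : F(S) → F(T) be positive homomorphisms of free groups such that g(of s) ≠ 1 for every s ∈ S. If a ∈ F(T) satisfies f(x) = a⁻¹·g(x)·a for all x ∈ F(S), then a is either positive or negative. -/
/-- An element of a free group is *positive* if it lies in the submonoid
generated by the canonical generators. -/
def IsPositive {S : Type*} (x : FreeGroup S) : Prop :=
  x ∈ Submonoid.closure (Set.range (FreeGroup.of : S → FreeGroup S))

/-- An element of a free group is *negative* if its inverse is positive. -/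
def IsNegative {S : Type*} (x : FreeGroup S) : Prop := IsPositive x⁻¹

/-- A homomorphism of free groups is *positive* if it sends each canonical
generator to a positive element. -/
def IsPositiveHom {S T : Type*} (f : FreeGroup S →* FreeGroup T) : Prop :=
  ∀ s : S, IsPositive (f (FreeGroup.of s))

namespace FreeGroup

variable {α : Type*}

/-- The product of two reduced words is obtained by cancelling a maximal suffix of the first
against a prefix of the second. -/
theorem IsReduced.exists_cancellation {L₁ L₂ : List (α × Bool)} (h₁ : IsReduced L₁)
    (h₂ : IsReduced L₂) : ∃ W C R : List (α × Bool),
      L₁ = W ++ invRev C ∧ L₂ = C ++ R ∧ IsReduced (W ++ R) := by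
  induction L₂ generalizing L₁ with
  | nil => exact ⟨L₁, [], [], by simp, by simp, by simpa using h₁⟩
  | cons x t ih =>
    by_cases hx : ∃ L, L₁ = L ++ [(x.1, !x.2)]
    · obtain ⟨L, rfl⟩ := hx
      obtain ⟨W, C, R, rfl, rfl, h⟩ := ih (h₁.infix (List.prefix_append _ _).isInfix)
        (h₂.infix (List.suffix_cons _ _).isInfix)
      exact ⟨W, x :: C, R, by simp [invRev], by simp, h⟩
    · refine ⟨L₁, [], x :: t, by simp, by simp, List.IsChain.append h₁ h₂ ?_⟩
      rintro ⟨y, b⟩ hy z hz hyz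
      obtain ⟨L, rfl⟩ := List.mem_getLast?_eq_getLast hy |>.elim fun h e =>
        (⟨_, (List.dropLast_append_getLast h).symm.trans (by rw [← e])⟩ :
          ∃ L, L₁ = L ++ [(y, b)])
      obtain rfl : x = z := by simpa using hz
      by_contra hb
      refine hx ⟨L, ?_⟩
      obtain rfl : y = x.1 := hyz
      simpa using Bool.eq_not.2 hb

theorem IsReduced.eq_of_mk_eq {L₁ L₂ : List (α × Bool)} (h₁ : IsReduced L₁)
    (h₂ : IsReduced L₂) (h : mk L₁ = mk L₂) : L₁ = L₂ := by
  classical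
  rw [← h₁.reduce_eq, ← h₂.reduce_eq, reduce.sound h]

theorem isReduced_of_forall_snd {L : List (α × Bool)} (h : ∀ p ∈ L, p.2 = true) :
    IsReduced L := by
  rw [IsReduced, List.isChain_iff_forall_rel_of_append_cons_cons]
  rintro a b l₁ l₂ rfl -
  rw [h a (by simp), h b (by simp)]

/-- A reduced word conjugating a long positive word to a positive word has letters of only
one sign. -/
theorem IsReduced.forall_snd_of_mul_eq_mul {A U V : List (α × Bool)} (hA : IsReduced A)
    (hU : ∀ p ∈ U, p.2 = true) (hV : ∀ p ∈ V, p.2 = true)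
    (hAU : 2 * A.length ≤ U.length) (h : mk U * mk A = mk A * mk V) :
    (∀ p ∈ A, p.2 = true) ∨ (∀ p ∈ A, p.2 = false) := by
  obtain ⟨W, C, R, rfl, hCR, hWR⟩ := (isReduced_of_forall_snd hU).exists_cancellation hA
  obtain ⟨P, D, Q, hPD, rfl, hPQ⟩ := hA.exists_cancellation (isReduced_of_forall_snd hV)
  have key : W ++ R = P ++ Q := by
    refine hWR.eq_of_mk_eq hPQ ?_
    have h₁ : mk W * mk R = mk (W ++ invRev C) * mk A := by
      rw [hCR, ← mul_mk, ← mul_mk, ← inv_mk]; group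
    have h₂ : mk P * mk Q = mk A * mk (D ++ Q) := by
      rw [hPD, ← mul_mk, ← mul_mk, ← inv_mk]; group
    rw [← mul_mk, ← mul_mk, h₁, h₂, h]
  have hC : ∀ p ∈ C, p.2 = false := fun p hp => by
    simpa using hU (p.1, !p.2) (by grind [invRev])
  have hD : ∀ p ∈ invRev D, p.2 = false := by
    intro p hp
    simp only [invRev, List.mem_reverse, List.mem_map] at hp
    obtain ⟨q, hq, rfl⟩ := hp
    simp [hV q (by simp [hq])]
  have hlen := congrArg List.length hCR
  have hlen' := congrArg List.length hPD
  simp only [List.length_append, invRev_length] at hAU hlen hlen'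
  have hP : P <+: W := List.prefix_of_prefix_length_le (l₃ := W ++ R)
    (key ▸ List.prefix_append _ _) (List.prefix_append _ _) (by omega)
  have hR : R <:+ Q := List.suffix_of_suffix_length_le (l₃ := P ++ Q)
    (key ▸ List.suffix_append _ _) (List.suffix_append _ _) (by
      have := congrArg List.length key
      simp only [List.length_append] at this
      omega)
  rcases C with _ | ⟨c, C⟩
  · left
    intro p hp
    exact hV p (List.mem_append_right _ (hR.subset (by simpa [hCR] using hp)))
  · right
    rcases P with _ | ⟨q, P⟩
    · simpa [hPD] using hD
    · have hcq : c = q := by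
        have := hCR.symm.trans hPD
        simp only [List.cons_append, List.cons.injEq] at this
        exact this.1
      have h₁ := hC c (by simp)
      have h₂ := hU q (List.mem_append_left _ (hP.subset (by simp)))
      simp_all

end FreeGroup

open FreeGroup

theorem isPositive_mk {α : Type*} {L : List (α × Bool)} (h : ∀ p ∈ L, p.2 = true) :
    IsPositive (mk L) := by
  induction L with
  | nil => exact one_mem _
  | cons x t ih =>
    obtain ⟨x, b⟩ := x
    obtain rfl : b = true := h _ List.mem_cons_self
    exact mul_mem (Submonoid.subset_closure (Set.mem_range_self x))
      (ih fun p hp => h p (List.mem_cons_of_mem _ hp))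

theorem IsPositive.exists_word {α : Type*} {x : FreeGroup α} (h : IsPositive x) :
    ∃ L : List (α × Bool), (∀ p ∈ L, p.2 = true) ∧ mk L = x := by
  induction h using Submonoid.closure_induction with
  | mem x hx =>
    obtain ⟨s, rfl⟩ := hx
    exact ⟨[(s, true)], by simp, rfl⟩
  | one => exact ⟨[], by simp, rfl⟩
  | mul x y _ _ hx hy =>
    obtain ⟨L, hL, rfl⟩ := hx
    obtain ⟨M, hM, rfl⟩ := hy
    exact ⟨L ++ M, by grind, mul_mk.symm⟩

/-- If two positive homomorphisms `f, g` of free groups with nontrivial images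
of the generators satisfy `f = c_a g`, then `a` is positive or negative. -/
theorem conjugator_pos_or_neg {S T : Type*} [Nonempty S]
    (f g : FreeGroup S →* FreeGroup T)
    (hf : IsPositiveHom f) (hg : IsPositiveHom g)
    (hne : ∀ s : S, g (FreeGroup.of s) ≠ 1)
    (a : FreeGroup T) (ha : ∀ x : FreeGroup S, f x = a⁻¹ * g x * a) :
    IsPositive a ∨ IsNegative a := by
  classical
  obtain ⟨s⟩ := ‹Nonempty S›
  obtain ⟨U, hU, hgU⟩ := (hg s).exists_word
  obtain ⟨V, hV, hfV⟩ := (hf s).exists_word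
  have hU0 : 0 < U.length := by
    rw [List.length_pos_iff]
    rintro rfl
    exact hne s hgU.symm
  set N := 2 * a.toWord.length
  have hlen : N ≤ (List.replicate N U).flatten.length := by
    simpa using Nat.le_mul_of_pos_right N hU0
  have hconj : mk (List.replicate N U).flatten * mk a.toWord
      = mk a.toWord * mk (List.replicate N V).flatten := by
    rw [← pow_mk, ← pow_mk, hgU, hfV, mk_toWord, ← map_pow, ← map_pow, ha]
    group
  rcases isReduced_toWord.forall_snd_of_mul_eq_mul (by grind [List.mem_flatten])
    (by grind [List.mem_flatten]) hlen hconj with h | h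
  · left
    simpa only [mk_toWord] using isPositive_mk h
  · right
    have hinv : IsPositive (mk (invRev a.toWord)) := isPositive_mk fun p hp => by
      simp only [invRev, List.mem_reverse, List.mem_map] at hp
      obtain ⟨q, hq, rfl⟩ := hp
      simp [h q hq]
    rwa [← inv_mk, mk_toWord] at hinv
end

section
/- Let S be a nonempty set and let f, g : F(S) → F(T) be positive homomorphisms of free groups such that g(of s) = w for every s ∈ S, where w is a fixed nontrivial (positive) element, and suppose f = c_a g for some a ∈ F(T). Then: (i) if a is positive, there exist n ∈ ℕ and a positive element v which is a strict prefix of w such that a = wⁿ·v and f = c_v g; (ii) if a is negative, there exist n ∈ ℕ and a negative element u such that u⁻¹ is a strict suffix of w, a = w⁻ⁿ·u, and f = c_u g. -/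
namespace FreeMonoid

variable {α : Type*}

/-- Levi lemma: two factorizations of the same word have a common refinement. -/
theorem mul_eq_mul_iff_exists {a b c d : FreeMonoid α} :
    a * b = c * d ↔ (∃ t, c = a * t ∧ b = t * d) ∨ ∃ t, a = c * t ∧ d = t * b :=
  List.append_eq_append_iff

/-- If `a * b = w * a`, then `a` is a power of `w` followed by a strict prefix of `w`. -/
theorem exists_eq_pow_mul_of_mul_eq_mul {w b : FreeMonoid α} (hw : w ≠ 1) (a : FreeMonoid α)
    (h : a * b = w * a) : ∃ (n : ℕ) (v t : FreeMonoid α), t ≠ 1 ∧ w = v * t ∧ a = w ^ n * v := by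
  rcases mul_eq_mul_iff_exists.1 h with ⟨t, hwt, -⟩ | ⟨a', ha, h'⟩
  · by_cases ht : t = 1
    · exact ⟨1, 1, w, hw, by simp, by simp [hwt, ht]⟩
    · exact ⟨0, a, t, ht, hwt, by simp⟩
  · have hlt : a'.length < a.length := by
      have := mt length_eq_zero.1 hw
      rw [ha, length_mul]
      omega
    obtain ⟨n, v, t, ht, hwt, ha'⟩ := exists_eq_pow_mul_of_mul_eq_mul hw a' (h'.symm.trans ha)
    exact ⟨n + 1, v, t, ht, hwt, by rw [ha, ha', pow_succ', mul_assoc]⟩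
termination_by a.length

/-- If `b * c = c * w`, then `c` is a strict suffix of `w` followed by a power of `w`. -/
theorem exists_eq_mul_pow_of_mul_eq_mul {w b : FreeMonoid α} (hw : w ≠ 1) (c : FreeMonoid α)
    (h : b * c = c * w) : ∃ (n : ℕ) (v s : FreeMonoid α), s ≠ 1 ∧ w = s * v ∧ c = v * w ^ n := by
  rcases mul_eq_mul_iff_exists.1 h with ⟨c', hc, h'⟩ | ⟨s, -, hws⟩
  · have hlt : c'.length < c.length := by
      have := mt length_eq_zero.1 hw
      rw [h', length_mul]
      omega
    obtain ⟨n, v, s, hs, hws, hc'⟩ := exists_eq_mul_pow_of_mul_eq_mul hw c' (hc.symm.trans h')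
    exact ⟨n + 1, v, s, hs, hws, by rw [h', hc', pow_succ, mul_assoc]⟩
  · by_cases hs : s = 1
    · exact ⟨1, 1, w, hw, by simp, by simp [hws, hs]⟩
    · exact ⟨0, c, s, hs, hws, by simp⟩
termination_by c.length

theorem lift_freeGroupOf_eq_mk (l : FreeMonoid α) :
    lift FreeGroup.of l = FreeGroup.mk (l.toList.map (·, true)) := by
  induction l using FreeMonoid.inductionOn' with
  | one => rfl
  | of_mul x l ih => rw [map_mul, ih]; rfl

/-- The free monoid embeds into the free group. -/
theorem lift_freeGroupOf_injective :
    Function.Injective (lift (FreeGroup.of : α → FreeGroup α)) := by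
  classical
  have reduced (l : FreeMonoid α) : FreeGroup.IsReduced (l.toList.map (·, true)) :=
    (List.isChain_map _).2 (List.isChain_iff_getElem.2 fun _ _ _ ↦ rfl)
  intro l m h
  rw [lift_freeGroupOf_eq_mk, lift_freeGroupOf_eq_mk] at h
  have h' := FreeGroup.reduce.sound h
  rw [(reduced l).reduce_eq, (reduced m).reduce_eq] at h'
  exact toList.injective (List.map_injective_iff.2 (fun _ _ e ↦ congrArg Prod.fst e) h')

end FreeMonoid

theorem isPositive_iff_exists_freeMonoid {α : Type*} {x : FreeGroup α} :
    IsPositive x ↔ ∃ l : FreeMonoid α, FreeMonoid.lift FreeGroup.of l = x := by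
  rw [IsPositive, ← FreeMonoid.mrange_lift, MonoidHom.mem_mrange]

/-- A homomorphism sending every generator to `w` has image centralizing `w`. -/
theorem FreeGroup.commute_map_of_forall_of_eq {α G : Type*} [Group G] (g : FreeGroup α →* G)
    {w : G} (hg : ∀ s, g (FreeGroup.of s) = w) (x : FreeGroup α) : Commute w (g x) := by
  induction x using FreeGroup.induction_on with
  | C1 => simp
  | of s => rw [hg]
  | inv_of s ih => rw [_root_.map_inv]; exact ih.inv_right
  | mul x y hx hy => rw [_root_.map_mul]; exact hx.mul_right hy

/-- Left factors commuting with `y` do not affect conjugation of `y`. -/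
theorem Commute.conj_mul_left {G : Type*} [Group G] {z y : G} (h : Commute z y) (v : G) :
    (z * v)⁻¹ * y * (z * v) = v⁻¹ * y * v := by
  rw [mul_inv_rev, ← mul_assoc, mul_assoc _ z⁻¹ y, h.inv_left.eq]
  group

/-- If positive homomorphisms `f, g` send every generator to the same
nontrivial positive word `w` and `f = c_a g`, then a positive conjugator `a`
has the form `wⁿ·v` with `v` a strict prefix of `w` and `f = c_v g`; a
negative conjugator has the form `w⁻ⁿ·u` with `u` negative, `u⁻¹` a strict
suffix of `w`, and `f = c_u g`. -/
theorem conjugator_power_reduction {S T : Type*} [Nonempty S]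
    (f g : FreeGroup S →* FreeGroup T)
    (hf : IsPositiveHom f) (hg : IsPositiveHom g)
    (w : FreeGroup T) (hw : IsPositive w) (hw1 : w ≠ 1)
    (hgw : ∀ s : S, g (FreeGroup.of s) = w)
    (a : FreeGroup T) (ha : ∀ x : FreeGroup S, f x = a⁻¹ * g x * a) :
    (IsPositive a → ∃ (n : ℕ) (v : FreeGroup T), IsPositive v ∧
      (∃ t : FreeGroup T, IsPositive t ∧ t ≠ 1 ∧ w = v * t) ∧
      a = w ^ n * v ∧
      (∀ x : FreeGroup S, f x = v⁻¹ * g x * v)) ∧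
    (IsNegative a → ∃ (n : ℕ) (u : FreeGroup T), IsNegative u ∧
      (∃ s : FreeGroup T, IsPositive s ∧ s ≠ 1 ∧ w = s * u⁻¹) ∧
      a = (w ^ n)⁻¹ * u ∧
      (∀ x : FreeGroup S, f x = u⁻¹ * g x * u)) := by
  obtain ⟨s₀⟩ := ‹Nonempty S›
  have hcomm := FreeGroup.commute_map_of_forall_of_eq g hgw
  have hinj := FreeMonoid.lift_freeGroupOf_injective (α := T)
  obtain ⟨b, hb⟩ := isPositive_iff_exists_freeMonoid.1 (hf s₀)
  rw [ha, hgw] at hb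
  obtain ⟨w, rfl⟩ := isPositive_iff_exists_freeMonoid.1 hw
  have hw' : w ≠ 1 := by
    rintro rfl
    exact hw1 (map_one _)
  refine ⟨fun hpos ↦ ?_, fun hneg ↦ ?_⟩
  · obtain ⟨a, rfl⟩ := isPositive_iff_exists_freeMonoid.1 hpos
    have h : a * b = w * a := hinj (by rw [map_mul, map_mul, hb]; group)
    obtain ⟨n, v, t, ht, hwt, hav⟩ := FreeMonoid.exists_eq_pow_mul_of_mul_eq_mul hw' a h
    have hav' := congrArg (FreeMonoid.lift FreeGroup.of) hav
    rw [map_mul, map_pow] at hav'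
    refine ⟨n, FreeMonoid.lift FreeGroup.of v, isPositive_iff_exists_freeMonoid.2 ⟨v, rfl⟩,
      ⟨FreeMonoid.lift FreeGroup.of t, isPositive_iff_exists_freeMonoid.2 ⟨t, rfl⟩,
        (map_ne_one_iff _ hinj).2 ht, by rw [hwt, map_mul]⟩, hav', fun x ↦ ?_⟩
    rw [ha, hav', ((hcomm x).pow_left n).conj_mul_left]
  · obtain ⟨c, hc⟩ := isPositive_iff_exists_freeMonoid.1 hneg
    obtain rfl := inv_eq_iff_eq_inv.1 hc.symm
    have h : b * c = c * w := hinj (by rw [map_mul, map_mul, hb]; group)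
    obtain ⟨n, v, s, hs, hws, hcv⟩ := FreeMonoid.exists_eq_mul_pow_of_mul_eq_mul hw' c h
    have hcv' := congrArg (fun l ↦ (FreeMonoid.lift FreeGroup.of l)⁻¹) hcv
    simp only [map_mul, map_pow, mul_inv_rev] at hcv'
    refine ⟨n, (FreeMonoid.lift FreeGroup.of v)⁻¹,
      isPositive_iff_exists_freeMonoid.2 ⟨v, (inv_inv _).symm⟩,
      ⟨FreeMonoid.lift FreeGroup.of s, isPositive_iff_exists_freeMonoid.2 ⟨s, rfl⟩,
        (map_ne_one_iff _ hinj).2 hs, by rw [hws, map_mul, inv_inv]⟩, hcv', fun x ↦ ?_⟩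
    rw [ha, hcv', ((hcomm x).pow_left n).inv_left.conj_mul_left]
end

section
/- Let F = F(Fin N) be the free group on finitely many generators. Let σ, τ, u, v : F → F be group homomorphisms with σ bijective and τ not surjective. Then for all natural numbers ℓ and m with m ≥ 1 and for every h ∈ F, it is NOT the case that h⁻¹ · σ^ℓ(x) · h = v(τ^m(u(x))) for all x ∈ F, where σ^ℓ and τ^m denote ℓ-fold and m-fold composition. -/
open Function

/-- Left multiplication by `x`, restricted to where it maps a finite set `S` into itself, extends to
a permutation of `S`. -/
theorem Finset.exists_perm_extending_mul_left {G : Type*} [Group G] (S : Finset G) (x : G) :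
    ∃ π : Equiv.Perm S, ∀ a b : S, x * (a : G) = b → π a = b := by
  classical
  obtain ⟨π, hπ⟩ := Finset.exists_equiv_extend_of_card_eq (α := S) (t := S) (by simp)
    (s := Finset.univ.filter fun a : S => x * (a : G) ∈ S) (f := fun a => x * (a : G))
    (by intro y; simp only [Finset.mem_image, Finset.mem_filter]; rintro ⟨a, ha, rfl⟩; exact ha.2)
    (fun a _ b _ hab => Subtype.ext (mul_left_cancel hab))
  refine ⟨π, fun a b hab => Subtype.ext ?_⟩
  rw [hπ a (by simp [hab]), hab]

/-- Every nontrivial element of a free group acts nontrivially in some action of the free group on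
a finite set. -/
theorem FreeGroup.exists_perm_hom_ne_one {α : Type*} {w : FreeGroup α} (hw : w ≠ 1) :
    ∃ (S : Finset (FreeGroup α)) (f : FreeGroup α →* Equiv.Perm S), f w ≠ 1 := by
  classical
  let S : Finset (FreeGroup α) := (w.toWord.tails.map FreeGroup.mk).toFinset
  have mem_S {s : List (α × Bool)} (hs : s <:+ w.toWord) : FreeGroup.mk s ∈ S := by
    simp only [S, List.mem_toFinset, List.mem_map, List.mem_tails]
    exact ⟨s, hs, rfl⟩
  choose π hπ using fun x : α => S.exists_perm_extending_mul_left (FreeGroup.of x)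
  let f : FreeGroup α →* Equiv.Perm S := FreeGroup.lift π
  let e : S := ⟨FreeGroup.mk [], mem_S List.nil_suffix⟩
  have orbit (s : List (α × Bool)) (hs : s <:+ w.toWord) :
      f (FreeGroup.mk s) e = ⟨FreeGroup.mk s, mem_S hs⟩ := by
    induction s with
    | nil => exact DFunLike.congr_fun f.map_one e
    | cons p t ih =>
      obtain ⟨x, b⟩ := p
      have ht : t <:+ w.toWord := (List.suffix_cons _ _).trans hs
      have hmul : FreeGroup.mk ((x, b) :: t) = FreeGroup.mk [(x, b)] * FreeGroup.mk t := by
        simp [FreeGroup.mul_mk]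
      have hf : f (FreeGroup.mk ((x, b) :: t)) e
          = f (FreeGroup.mk [(x, b)]) ⟨FreeGroup.mk t, mem_S ht⟩ := by
        rw [hmul, f.map_mul, Equiv.Perm.mul_apply, ih ht]
      rw [hf]
      cases b with
      | true =>
        have : f (FreeGroup.mk [(x, true)]) = π x := FreeGroup.lift_apply_of
        rw [this]
        exact hπ x _ _ hmul.symm
      | false =>
        have hinv : FreeGroup.mk [(x, false)] = (FreeGroup.of x)⁻¹ := rfl
        have : f (FreeGroup.mk [(x, false)]) = (π x)⁻¹ := by
          rw [hinv, f.map_inv]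
          exact congrArg _ FreeGroup.lift_apply_of
        rw [this, Equiv.Perm.inv_eq_iff_eq]
        refine (hπ x _ _ ?_).symm
        simp only [hmul, hinv, mul_inv_cancel_left]
  refine ⟨S, f, fun hfw => hw ?_⟩
  have hmem := congrArg Subtype.val (orbit w.toWord List.suffix_rfl)
  simp only [FreeGroup.mk_toWord, hfw, Equiv.Perm.one_apply] at hmem
  exact hmem.symm

/-- Finitely generated free groups are Hopfian. -/
theorem FreeGroup.injective_of_surjective_endomorphism {α : Type*} [Finite α]
    {φ : FreeGroup α →* FreeGroup α} (hφ : Surjective φ) : Injective φ := by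
  rw [injective_iff_map_eq_one]
  intro w hw
  by_contra hne
  obtain ⟨S, f, hf⟩ := FreeGroup.exists_perm_hom_ne_one hne
  have : Finite (FreeGroup α →* Equiv.Perm S) := Finite.of_equiv _ FreeGroup.lift
  have hinj : Injective fun g : FreeGroup α →* Equiv.Perm S => g.comp φ :=
    fun _ _ h => (MonoidHom.cancel_right hφ).1 h
  obtain ⟨g, rfl⟩ := Finite.surjective_of_injective hinj f
  exact hf (by simp [hw])

/-- In a finitely generated free group, a power of an invertible endomorphism
is never conjugate to a composition passing through a power of a
non-surjective endomorphism. -/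
theorem invertible_power_not_conjugate_through_noninvertible
    (N : ℕ) (σ τ u v : FreeGroup (Fin N) →* FreeGroup (Fin N))
    (hσ : Function.Bijective σ) (hτ : ¬ Function.Surjective τ) :
    ∀ (ℓ m : ℕ), 1 ≤ m → ∀ h : FreeGroup (Fin N),
      ¬ (∀ x : FreeGroup (Fin N),
        h⁻¹ * (⇑σ)^[ℓ] x * h = v ((⇑τ)^[m] (u x))) := by
  intro ℓ m hm h H
  have hcomp : Surjective (v ∘ (⇑τ)^[m] ∘ u) := fun y => by
    obtain ⟨x, hx⟩ := hσ.surjective.iterate ℓ (h * y * h⁻¹)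
    refine ⟨x, ?_⟩
    rw [comp_apply, comp_apply, ← H, hx]
    group
  have hv : Injective v := FreeGroup.injective_of_surjective_endomorphism hcomp.of_comp
  have hτm : Surjective (⇑τ)^[m] := (hcomp.of_comp_left hv).of_comp
  obtain ⟨k, rfl⟩ := Nat.exists_eq_add_of_le' hm
  rw [iterate_succ'] at hτm
  exact hτ hτm.of_comp
end

section
/- Let F₂ = F(Fin 2) be the free group on two generators a and b. The endomorphism σ of F₂ determined by σ(a) = a·a·b·a·a·b·a·b and σ(b) = a·a·b·a·b (i.e. the words aabaabab and aabab) is bijective, i.e. an automorphism of F₂. -/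
open FreeGroup

/-- The generator `a` of the free group on two generators. -/
noncomputable def a : FreeGroup (Fin 2) := FreeGroup.of 0

/-- The generator `b` of the free group on two generators. -/
noncomputable def b : FreeGroup (Fin 2) := FreeGroup.of 1

/-- The substitution endomorphism `σ : a ↦ aabaabab, b ↦ aabab`. -/
noncomputable def σ : FreeGroup (Fin 2) →* FreeGroup (Fin 2) :=
  FreeGroup.lift ![a * a * b * a * a * b * a * b, a * a * b * a * b]

/-- The inverse of `σ`. -/
noncomputable def sigmaInv : FreeGroup (Fin 2) →* FreeGroup (Fin 2) :=
  FreeGroup.lift ![a * b⁻¹ * b⁻¹ * a * b⁻¹, b * a⁻¹ * b * b * a⁻¹ * b * a⁻¹ * b]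

lemma sigma_a : σ a = a * a * b * a * a * b * a * b := by
  simp [σ, a]

lemma sigma_b : σ b = a * a * b * a * b := by
  simp [σ, b]

lemma sigmaInv_a : sigmaInv a = a * b⁻¹ * b⁻¹ * a * b⁻¹ := by
  simp [sigmaInv, a]

lemma sigmaInv_b : sigmaInv b = b * a⁻¹ * b * b * a⁻¹ * b * a⁻¹ * b := by
  simp [sigmaInv, b]

/-- Endomorphisms of the free group on `a` and `b` agreeing on `a` and `b` are equal. -/
lemma hom_ext_a_b {f g : FreeGroup (Fin 2) →* FreeGroup (Fin 2)}
    (ha : f a = g a) (hb : f b = g b) : f = g := by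
  ext i
  fin_cases i
  · exact ha
  · exact hb

lemma sigmaInv_comp_sigma : sigmaInv.comp σ = MonoidHom.id _ := by
  apply hom_ext_a_b <;>
    simp only [MonoidHom.comp_apply, MonoidHom.id_apply, sigma_a, sigma_b, _root_.map_mul,
      sigmaInv_a, sigmaInv_b] <;>
    group

lemma sigma_comp_sigmaInv : σ.comp sigmaInv = MonoidHom.id _ := by
  apply hom_ext_a_b <;>
    simp only [MonoidHom.comp_apply, MonoidHom.id_apply, sigma_a, sigma_b, _root_.map_mul,
      _root_.map_inv, sigmaInv_a, sigmaInv_b] <;>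
    group

/-- The endomorphism `σ` (a ↦ aabaabab, b ↦ aabab) is an automorphism of the
free group on two generators. -/
theorem sigma_bijective : Function.Bijective σ := by
  exact Function.bijective_iff_has_inverse.mpr
    ⟨sigmaInv, DFunLike.congr_fun sigmaInv_comp_sigma, DFunLike.congr_fun sigma_comp_sigmaInv⟩
end

section
/- Let F₂ = F(Fin 2) be the free group on two generators a and b. The endomorphism τ of F₂ determined by τ(a) = a·a·b·a·a·b·a·b and τ(b) = a·b·a·a·b (i.e. the words aabaabab and abaab) is not surjective; in particular it is not an automorphism of F₂. -/
/-- The substitution endomorphism `τ : a ↦ aabaabab, b ↦ abaab`. -/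
noncomputable def τ : FreeGroup (Fin 2) →* FreeGroup (Fin 2) :=
  FreeGroup.lift ![a * a * b * a * a * b * a * b, a * b * a * a * b]

/-- The action of the free group on three points in which `a` acts as a transposition and `b` as a
3-cycle. -/
def permRep : FreeGroup (Fin 2) →* Equiv.Perm (Fin 3) :=
  FreeGroup.lift ![Equiv.swap 0 1, (finRotate 3)⁻¹]

/-- Every element in the image of `τ` fixes the point `0` under `permRep`. -/
theorem permRep_tau_apply_zero (g : FreeGroup (Fin 2)) : permRep (τ g) 0 = 0 := by
  induction g using FreeGroup.induction_on with
  | C1 => simp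
  | of i => fin_cases i <;> simp [permRep, τ, a, b] <;> decide
  | inv_of i h => rw [map_inv, map_inv, Equiv.Perm.inv_eq_iff_eq, h]
  | mul g h hg hh => rw [map_mul, map_mul, Equiv.Perm.mul_apply, hh, hg]

/-- The endomorphism `τ` (a ↦ aabaabab, b ↦ abaab) is not surjective, hence
not an automorphism of the free group on two generators. -/
theorem tau_not_surjective : ¬ Function.Surjective τ := by
  intro hτ
  obtain ⟨g, hg⟩ := hτ a
  have h := permRep_tau_apply_zero g
  simp [hg, permRep, a] at h
end

section
/- Every matrix M in GL₂(ℤ) all of whose entries are nonnegative has a unique factorization M = M₀ · M₁ · ⋯ · M_k, where M₀ belongs to { [[1,0],[0,1]], [[0,1],[1,0]] } and each M_i for 1 ≤ i ≤ k belongs to { [[1,1],[0,1]], [[1,0],[1,1]] }; uniqueness means that both M₀ and the finite sequence (M₁, …, M_k) (including its length k) are uniquely determined by M. -/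
/-- A product of matrices `[[1,1],[0,1]]` and `[[1,0],[1,1]]` has nonnegative entries and
determinant `1`. -/
lemma exists_prod_eq_of_elementary (l : List (Matrix (Fin 2) (Fin 2) ℤ))
    (hl : ∀ A ∈ l, A = !![1, 1; 0, 1] ∨ A = !![1, 0; 1, 1]) :
    ∃ a b c d : ℤ, l.prod = !![a, b; c, d] ∧ 0 ≤ a ∧ 0 ≤ b ∧ 0 ≤ c ∧ 0 ≤ d ∧
      a * d - b * c = 1 := by
  induction l with
  | nil => exact ⟨1, 0, 0, 1, by simp [Matrix.one_fin_two], by norm_num⟩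
  | cons A l ih =>
    obtain ⟨a, b, c, d, hp, ha, hb, hc, hd, hdet⟩ :=
      ih fun B hB => hl B (List.mem_cons_of_mem _ hB)
    rcases hl A List.mem_cons_self with rfl | rfl
    · exact ⟨a + c, b + d, c, d, by simp [hp], by omega, by omega, hc, hd, by linarith⟩
    · exact ⟨a, b, a + c, b + d, by simp [hp], ha, hb, by omega, by omega, by linarith⟩

/-- Every nonnegative integer matrix of determinant `1` is a product of matrices `[[1,1],[0,1]]`
and `[[1,0],[1,1]]`. -/
lemma exists_elementary_factorization (n : ℕ) (a b c d : ℤ) (ha : 0 ≤ a) (hb : 0 ≤ b)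
    (hc : 0 ≤ c) (hd : 0 ≤ d) (hdet : a * d - b * c = 1) (hn : a + b + c + d ≤ n) :
    ∃ l : List (Matrix (Fin 2) (Fin 2) ℤ),
      (∀ A ∈ l, A = !![1, 1; 0, 1] ∨ A = !![1, 0; 1, 1]) ∧ l.prod = !![a, b; c, d] := by
  induction n generalizing a b c d with
  | zero =>
    obtain rfl : a = 0 := by push_cast at hn; omega
    obtain rfl : b = 0 := by push_cast at hn; omega
    simp at hdet
  | succ n ih =>
    push_cast at hn
    have hrow₁ : 0 < a + b := by
      by_contra h
      obtain rfl : a = 0 := by omega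
      obtain rfl : b = 0 := by omega
      simp at hdet
    have hrow₂ : 0 < c + d := by
      by_contra h
      obtain rfl : c = 0 := by omega
      obtain rfl : d = 0 := by omega
      simp at hdet
    by_cases hupper : c ≤ a ∧ d ≤ b
    · obtain ⟨l, hl, hp⟩ := ih (a - c) (b - d) c d (by omega) (by omega) hc hd
        (by linarith) (by omega)
      exact ⟨!![1, 1; 0, 1] :: l, by simpa using hl, by simp [hp]⟩
    by_cases hlower : a ≤ c ∧ b ≤ d
    · obtain ⟨l, hl, hp⟩ := ih a b (c - a) (d - b) ha hb (by omega) (by omega)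
        (by linarith) (by omega)
      exact ⟨!![1, 0; 1, 1] :: l, by simpa using hl, by simp [hp]⟩
    have hcases : (a < c ∧ d < b) ∨ (c < a ∧ b < d) := by omega
    rcases hcases with ⟨hac, hdb⟩ | ⟨hca, hbd⟩
    · nlinarith
    · have hprod : (c + 1) * (b + 1) ≤ a * d :=
        mul_le_mul (by omega) (by omega) (by omega) ha
      obtain rfl : b = 0 := by nlinarith
      obtain rfl : c = 0 := by nlinarith
      obtain rfl : a = 1 := by nlinarith
      obtain rfl : d = 1 := by omega
      exact ⟨[], by simp, by simp [Matrix.one_fin_two]⟩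

/-- The matrices `[[1,1],[0,1]]` and `[[1,0],[1,1]]` freely generate the monoid they span. -/
lemma eq_of_elementary_prod_eq (l m : List (Matrix (Fin 2) (Fin 2) ℤ))
    (hl : ∀ A ∈ l, A = !![1, 1; 0, 1] ∨ A = !![1, 0; 1, 1])
    (hm : ∀ A ∈ m, A = !![1, 1; 0, 1] ∨ A = !![1, 0; 1, 1])
    (h : l.prod = m.prod) : l = m := by
  induction l generalizing m with
  | nil =>
    cases m with
    | nil => rfl
    | cons B m =>
      exfalso
      obtain ⟨a, b, c, d, hp, ha, hb, hc, hd, hdet⟩ :=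
        exists_prod_eq_of_elementary m fun C hC => hm C (List.mem_cons_of_mem _ hC)
      rcases hm B List.mem_cons_self with rfl | rfl <;>
        simp [hp, Matrix.one_fin_two] at h <;> omega
  | cons A l ih =>
    have hl' := fun C hC => hl C (List.mem_cons_of_mem A hC)
    obtain ⟨a, b, c, d, hp, ha, hb, hc, hd, hdet⟩ := exists_prod_eq_of_elementary l hl'
    cases m with
    | nil =>
      exfalso
      rcases hl A List.mem_cons_self with rfl | rfl <;>
        simp [hp, Matrix.one_fin_two] at h <;> omega
    | cons B m =>
      have hm' := fun C hC => hm C (List.mem_cons_of_mem B hC)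
      obtain ⟨a', b', c', d', hp', ha', hb', hc', hd', hdet'⟩ :=
        exists_prod_eq_of_elementary m hm'
      have hAB : A = B := by
        rcases hl A List.mem_cons_self with rfl | rfl <;>
          rcases hm B List.mem_cons_self with rfl | rfl
        · rfl
        · exfalso
          simp [hp, hp'] at h
          obtain rfl : a = 0 := by omega
          obtain rfl : b = 0 := by omega
          simp at hdet
        · exfalso
          simp [hp, hp'] at h
          obtain rfl : c = 0 := by omega
          obtain rfl : d = 0 := by omega
          simp at hdet
        · rfl
      subst hAB
      have hunit : IsUnit A := by
        rw [Matrix.isUnit_iff_isUnit_det]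
        rcases hl A List.mem_cons_self with rfl | rfl <;> simp
      rw [List.prod_cons, List.prod_cons] at h
      rw [ih m hl' hm' (hunit.mul_left_cancel h)]

/-- Every nonnegative matrix in `GL₂(ℤ)` has a unique factorization
`M = M₀ · M₁ ⋯ M_k` with `M₀ ∈ {I, [[0,1],[1,0]]}` and each `M_i`
(`i ≥ 1`) in `{[[1,1],[0,1]], [[1,0],[1,1]]}`. -/
theorem nonneg_GL2_unique_factorization
    (M : Matrix.GeneralLinearGroup (Fin 2) ℤ)
    (hM : ∀ i j, 0 ≤ (M : Matrix (Fin 2) (Fin 2) ℤ) i j) :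
    ∃! P : Matrix (Fin 2) (Fin 2) ℤ × List (Matrix (Fin 2) (Fin 2) ℤ),
      (P.1 = !![1, 0; 0, 1] ∨ P.1 = !![0, 1; 1, 0]) ∧
      (∀ A ∈ P.2, A = !![1, 1; 0, 1] ∨ A = !![1, 0; 1, 1]) ∧
      P.1 * P.2.prod = (M : Matrix (Fin 2) (Fin 2) ℤ) := by
  refine existsUnique_of_exists_of_unique ?_ ?_
  · have hdet : IsUnit (M : Matrix (Fin 2) (Fin 2) ℤ).det :=
      (Matrix.isUnit_iff_isUnit_det _).mp M.isUnit
    generalize (M : Matrix (Fin 2) (Fin 2) ℤ) = N at hM hdet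
    rw [Int.isUnit_iff, Matrix.det_fin_two] at hdet
    rcases hdet with hdet | hdet
    · obtain ⟨l, hl, hp⟩ := exists_elementary_factorization _ _ _ _ _ (hM 0 0) (hM 0 1)
        (hM 1 0) (hM 1 1) hdet (Int.self_le_toNat _)
      refine ⟨(!![1, 0; 0, 1], l), Or.inl rfl, hl, ?_⟩
      rw [hp, ← Matrix.one_fin_two, one_mul, ← Matrix.eta_fin_two]
    · obtain ⟨l, hl, hp⟩ := exists_elementary_factorization _ _ _ _ _ (hM 1 0) (hM 1 1)
        (hM 0 0) (hM 0 1) (by linarith) (Int.self_le_toNat _)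
      refine ⟨(!![0, 1; 1, 0], l), Or.inr rfl, hl, ?_⟩
      rw [hp, Matrix.eta_fin_two N]
      simp
  · rintro ⟨S, l⟩ ⟨T, m⟩ ⟨hS, hl, hP⟩ ⟨hT, hm, hQ⟩
    dsimp only at hS hl hP hT hm hQ
    have hdet_prod : ∀ k : List (Matrix (Fin 2) (Fin 2) ℤ),
        (∀ A ∈ k, A = !![1, 1; 0, 1] ∨ A = !![1, 0; 1, 1]) → k.prod.det = 1 := by
      intro k hk
      obtain ⟨a, b, c, d, hp, -, -, -, -, hdet⟩ := exists_prod_eq_of_elementary k hk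
      rw [hp, Matrix.det_fin_two_of, hdet]
    have hdetS : S.det = T.det := by
      have h := congrArg Matrix.det (hP.trans hQ.symm)
      rwa [Matrix.det_mul, Matrix.det_mul, hdet_prod l hl, hdet_prod m hm, mul_one,
        mul_one] at h
    have hST : S = T := by
      rcases hS with rfl | rfl <;> rcases hT with rfl | rfl <;>
        simp [Matrix.det_fin_two_of] at hdetS ⊢
    subst hST
    have hunit : IsUnit S := by
      rw [Matrix.isUnit_iff_isUnit_det]
      rcases hS with rfl | rfl <;> simp
    rw [eq_of_elementary_prod_eq l m hl hm (hunit.mul_left_cancel (hP.trans hQ.symm))]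
end
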